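/- Let A = ⊕_{i∈ℤ} A_i be a ℤ-graded finitely generated normal integral domain over ℂ of Krull dimension 2 with A_0 of Krull dimension 1 and A_1 ≠ 0, and assume A is either parabolic (A_i = 0 for all i < 0) or hyperbolic (A_{-1} ≠ 0). Let ∂ and ∂' be nonzero locally nilpotent ℂ-derivations of A, both homogeneous of the same degree e; in the parabolic case assume moreover e ≥ 0. Then ∂ and ∂' are proportional: ∂' = c·∂ for some c ∈ ℂ, c ≠ 0. -/

import Mathlib

/-- A `ℂ`-derivation `D` of a commutative `ℂ`-algebra `A` is locally nilpotent if for every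
`f ∈ A` there is `n` with `D^[n] f = 0`. -/
def Derivation.IsLocallyNilpotent {A : Type*} [CommRing A] [Algebra ℂ A]
    (D : Derivation ℂ A A) : Prop :=
  ∀ f : A, ∃ n : ℕ, (⇑D)^[n] f = 0

theorem ringKrullDim_le_of_isIntegral_of_injective {R S : Type*} [CommRing R] [CommRing S]
    [Algebra R S] [Algebra.IsIntegral R S] (hinj : Function.Injective (algebraMap R S)) :
    ringKrullDim R ≤ ringKrullDim S := by
  refine iSup_le fun l ↦ ?_
  have : FaithfulSMul R S := (faithfulSMul_iff_algebraMap_injective R S).mpr hinj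
  obtain ⟨⟨P, hP⟩, hPl⟩ := Algebra.IsIntegral.comap_surjective R S l.head
  have hlo : P.LiesOver l.head.asIdeal := ⟨by rw [← hPl]; rfl⟩
  obtain ⟨L, hL, -⟩ := Ideal.exists_ltSeries_of_hasGoingUp l P
  rw [← hL]
  exact le_iSup (fun p : LTSeries (PrimeSpectrum S) ↦ (p.length : WithBot ℕ∞)) L

theorem trdeg_le_of_ringKrullDim_le (k : Type*) {R : Type*} [Field k] [CommRing R] [IsDomain R]
    [Algebra k R] [Algebra.FiniteType k R] {n : ℕ} (h : ringKrullDim R ≤ n) :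
    Algebra.trdeg k R ≤ n := by
  obtain ⟨s, g, hg, hint⟩ := exists_integral_inj_algHom_of_fg k R
  algebraize [g.toRingHom]
  have : Algebra.IsIntegral (MvPolynomial (Fin s) k) R := ⟨hint⟩
  have hs : s ≤ n := by
    have h1 := (ringKrullDim_le_of_isIntegral_of_injective
      (R := MvPolynomial (Fin s) k) (S := R) hg).trans h
    rw [MvPolynomial.ringKrullDim_of_isNoetherianRing, ringKrullDim_eq_zero_of_field] at h1
    simpa using h1
  have : FaithfulSMul (MvPolynomial (Fin s) k) R :=
    (faithfulSMul_iff_algebraMap_injective _ R).mpr hg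
  have : IsScalarTower k (MvPolynomial (Fin s) k) R :=
    IsScalarTower.of_algebraMap_eq fun c ↦ (g.commutes c).symm
  have htr := lift_trdeg_add_eq k (MvPolynomial (Fin s) k) R
  rw [trdeg_eq_zero (R := MvPolynomial (Fin s) k) (A := R), MvPolynomial.trdeg_of_isDomain] at htr
  have htr' : Algebra.trdeg k R = s := by
    rw [← Cardinal.lift_inj, ← htr]
    simp
  rw [htr']
  exact_mod_cast hs

theorem AlgebraicIndependent.le_of_ringKrullDim_le {k R : Type*} [Field k] [CommRing R] [IsDomain R]
    [Algebra k R] [Algebra.FiniteType k R] {n m : ℕ} (h : ringKrullDim R ≤ n) {x : Fin m → R}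
    (hx : AlgebraicIndependent k x) : m ≤ n := by
  have := hx.lift_cardinalMk_le_trdeg.trans
    (Cardinal.lift_le.mpr (trdeg_le_of_ringKrullDim_le k h))
  simpa using this

section LocallyNilpotent

variable {A : Type*} [CommRing A] [Algebra ℂ A]

/-- `D.HasOrder x n` says that `n` is the largest number with `D^[n] x ≠ 0`. -/
def Derivation.HasOrder (D : Derivation ℂ A A) (x : A) (n : ℕ) : Prop :=
  (⇑D)^[n] x ≠ 0 ∧ (⇑D)^[n + 1] x = 0

namespace Derivation

variable {D : Derivation ℂ A A} {x y : A} {m n : ℕ}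

theorem iterate_sum_arg (D : Derivation ℂ A A) (n : ℕ) {ι : Type*} (s : Finset ι) (f : ι → A) :
    (⇑D)^[n] (∑ i ∈ s, f i) = ∑ i ∈ s, (⇑D)^[n] (f i) := by
  have h := map_sum ((D : A →ₗ[ℂ] A) ^ n) f s
  simp only [Module.End.pow_apply] at h
  exact h

theorem iterate_eq_zero_of_le (h : (⇑D)^[m] x = 0) (hmn : m ≤ n) : (⇑D)^[n] x = 0 := by
  obtain ⟨k, rfl⟩ := Nat.exists_eq_add_of_le' hmn
  rw [Function.iterate_add_apply, h, iterate_map_zero]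

theorem IsLocallyNilpotent.exists_hasOrder (hD : D.IsLocallyNilpotent) (hx : x ≠ 0) :
    ∃ n, D.HasOrder x n := by
  classical
  have h0 : Nat.find (hD x) ≠ 0 := fun h ↦ hx (by simpa [h] using Nat.find_spec (hD x))
  obtain ⟨n, hn⟩ := Nat.exists_eq_succ_of_ne_zero h0
  exact ⟨n, Nat.find_min (hD x) (by omega), by simpa [hn] using Nat.find_spec (hD x)⟩

theorem HasOrder.ne_zero (h : D.HasOrder x n) : x ≠ 0 := by
  rintro rfl
  exact h.1 (iterate_map_zero D n)

theorem HasOrder.le_of_iterate_ne_zero (h : D.HasOrder x n) (hm : (⇑D)^[m] x ≠ 0) : m ≤ n := by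
  by_contra! hlt
  exact hm (iterate_eq_zero_of_le h.2 hlt)

theorem HasOrder.unique (hm : D.HasOrder x m) (hn : D.HasOrder x n) : m = n :=
  le_antisymm (hn.le_of_iterate_ne_zero hm.1) (hm.le_of_iterate_ne_zero hn.1)

theorem hasOrder_zero_iff : D.HasOrder x 0 ↔ x ≠ 0 ∧ D x = 0 := Iff.rfl

theorem HasOrder.pos (h : D.HasOrder x n) (hx : D x ≠ 0) : 0 < n :=
  h.le_of_iterate_ne_zero (m := 1) hx

theorem HasOrder.map (h : D.HasOrder x (n + 1)) : D.HasOrder (D x) n := h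

theorem iterate_mul_of_iterate_eq_zero (hx : (⇑D)^[m + 1] x = 0) (hy : (⇑D)^[n + 1] y = 0) :
    (⇑D)^[m + n + 1] (x * y) = 0 ∧
      (⇑D)^[m + n] (x * y) = (m + n).choose m • ((⇑D)^[m] x * (⇑D)^[n] y) := by
  have step (k : ℕ) (u v : A) :
      (⇑D)^[k + 1] (u * v) = (⇑D)^[k] (D u * v) + (⇑D)^[k] (u * D v) := by
    rw [Function.iterate_succ_apply, leibniz, iterate_map_add, smul_eq_mul, smul_eq_mul,
      mul_comm v, add_comm]
  induction hN : m + n generalizing m n x y with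
  | zero =>
    obtain ⟨rfl, rfl⟩ : m = 0 ∧ n = 0 := by omega
    replace hx : D x = 0 := hx
    replace hy : D y = 0 := hy
    simp [hx, hy]
  | succ N ih =>
    rcases m with - | m
    · replace hx : D x = 0 := hx
      obtain rfl : n = N + 1 := by omega
      have := ih (m := 0) (n := N) (x := x) (y := D y) hx hy (by omega)
      rw [step (N + 1) x y, step N x y, hx]
      simpa [iterate_map_zero] using this
    rcases n with - | n
    · replace hy : D y = 0 := hy
      obtain rfl : m = N := by omega
      have := ih (m := m) (n := 0) (x := D x) (y := y) hx hy (by omega)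
      rw [step (m + 1) x y, step m x y, hy]
      simpa [iterate_map_zero] using this
    · have h1 := ih (m := m) (n := n + 1) (x := D x) (y := y) hx hy (by omega)
      have h2 := ih (m := m + 1) (n := n) (x := x) (y := D y) hx hy (by omega)
      rw [step (N + 1) x y, step N x y, h1.1, h2.1, h1.2, h2.2, ← Function.iterate_succ_apply,
        ← Function.iterate_succ_apply, ← add_nsmul, Nat.choose_succ_succ]
      simp

variable [IsDomain A]

theorem HasOrder.mul (hx : D.HasOrder x m) (hy : D.HasOrder y n) :
    D.HasOrder (x * y) (m + n) := by
  have : CharZero A := charZero_of_injective_algebraMap (FaithfulSMul.algebraMap_injective ℂ A)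
  obtain ⟨h0, h1⟩ := iterate_mul_of_iterate_eq_zero hx.2 hy.2
  refine ⟨?_, h0⟩
  rw [h1]
  exact smul_ne_zero (Nat.choose_pos (Nat.le_add_right m n)).ne' (mul_ne_zero hx.1 hy.1)

theorem HasOrder.pow (hx : D.HasOrder x m) (k : ℕ) : D.HasOrder (x ^ k) (k * m) := by
  induction k with
  | zero => simp [hasOrder_zero_iff]
  | succ k ih => simpa [pow_succ, Nat.succ_mul] using ih.mul hx

theorem IsLocallyNilpotent.map_eq_zero_of_map_mul_eq_zero (hD : D.IsLocallyNilpotent)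
    (hxy : x * y ≠ 0) (h : D (x * y) = 0) : D x = 0 := by
  obtain ⟨m, hm⟩ := hD.exists_hasOrder (left_ne_zero_of_mul hxy)
  obtain ⟨n, hn⟩ := hD.exists_hasOrder (right_ne_zero_of_mul hxy)
  have h0 := (hm.mul hn).unique (hasOrder_zero_iff.mpr ⟨hxy, h⟩)
  obtain rfl : m = 0 := by omega
  exact hm.2

theorem IsLocallyNilpotent.map_eq_zero_of_map_pow_eq_zero (hD : D.IsLocallyNilpotent) {k : ℕ}
    (hk : k ≠ 0) (h : D (x ^ k) = 0) : D x = 0 := by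
  by_cases hx : x = 0
  · simp [hx]
  obtain ⟨k, rfl⟩ := Nat.exists_eq_succ_of_ne_zero hk
  rw [pow_succ'] at h
  exact hD.map_eq_zero_of_map_mul_eq_zero (mul_ne_zero hx (pow_ne_zero _ hx)) h

omit [IsDomain A] in
theorem eq_zero_of_sum_eq_zero_of_hasOrder {ι : Type*} {s : Finset ι} {f : ι → A} {o : ι → ℕ}
    (ho : ∀ i ∈ s, f i ≠ 0 → D.HasOrder (f i) (o i)) (hinj : Set.InjOn o s)
    (hsum : ∑ i ∈ s, f i = 0) : ∀ i ∈ s, f i = 0 := by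
  classical
  by_contra! hne
  have hs : (s.filter fun i ↦ f i ≠ 0).Nonempty := by
    obtain ⟨i, hi, hfi⟩ := hne
    exact ⟨i, by simp [hi, hfi]⟩
  obtain ⟨i, hi, hmax⟩ := Finset.exists_max_image _ o hs
  obtain ⟨his, hfi⟩ := Finset.mem_filter.mp hi
  refine (ho i his hfi).1 ?_
  have h := congrArg (⇑D)^[o i] hsum
  rw [iterate_sum_arg, iterate_map_zero, Finset.sum_eq_single_of_mem i his] at h
  · exact h
  · intro j hj hji
    by_cases hfj : f j = 0
    · rw [hfj, iterate_map_zero]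
    · refine iterate_eq_zero_of_le (ho j hj hfj).2 ?_
      have h1 := hmax j (by simp [hj, hfj])
      have h2 : o j ≠ o i := fun h ↦ hji (hinj hj his h)
      omega

theorem IsLocallyNilpotent.coeff_eq_zero_of_sum_pow_mul_eq_zero (hD : D.IsLocallyNilpotent)
    {a : A} (ha : D a ≠ 0) {s : Finset ℕ} {b : ℕ → A} (hb : ∀ l ∈ s, D (b l) = 0)
    (hsum : ∑ l ∈ s, a ^ l * b l = 0) : ∀ l ∈ s, b l = 0 := by
  have ha0 : a ≠ 0 := by rintro rfl; simp at ha
  obtain ⟨m, hm⟩ := hD.exists_hasOrder ha0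
  have hm0 := hm.pos ha
  have := eq_zero_of_sum_eq_zero_of_hasOrder (D := D) (o := fun l ↦ l * m) (fun l hl hne ↦ by
    simpa using (hm.pow l).mul (hasOrder_zero_iff.mpr ⟨right_ne_zero_of_mul hne, hb l hl⟩))
    (fun l _ l' _ h ↦ Nat.eq_of_mul_eq_mul_right hm0 h) hsum
  exact fun l hl ↦ (mul_eq_zero.mp (this l hl)).resolve_left (pow_ne_zero _ ha0)

end Derivation

end LocallyNilpotent

section Graded

variable {A : Type*} [CommRing A] [Algebra ℂ A] (𝒜 : ℤ → Submodule ℂ A)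

theorem exists_eq_smul_of_sum_smul_pow_mul_pow_eq_zero [IsDomain A] {x y : A} (hy : y ≠ 0) {k : ℕ}
    {c : ℕ → ℂ} (hc : ∃ j < k + 1, c j ≠ 0)
    (hsum : ∑ j ∈ Finset.range (k + 1), c j • (x ^ j * y ^ (k - j)) = 0) :
    ∃ z : ℂ, x = z • y := by
  let K := FractionRing A
  have hyK : algebraMap A K y ≠ 0 := by simpa using hy
  let w : K := algebraMap A K x / algebraMap A K y
  let p : Polynomial ℂ := ∑ j ∈ Finset.range (k + 1), Polynomial.monomial j (c j)
  have hp : p ≠ 0 := by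
    obtain ⟨j, hj, hcj⟩ := hc
    intro h
    apply hcj
    have := congrArg (Polynomial.coeff · j) h
    simpa [p, Polynomial.finsetSum_coeff, Polynomial.coeff_monomial, hj] using this
  have hpw : Polynomial.aeval w p = 0 := by
    have h := congrArg (algebraMap A K) hsum
    rw [map_sum, map_zero] at h
    have h2 : Polynomial.aeval w p * algebraMap A K y ^ k = 0 := by
      rw [← h, map_sum, Finset.sum_mul]
      refine Finset.sum_congr rfl fun j hj ↦ ?_
      have hjk : j ≤ k := Nat.lt_succ_iff.mp (Finset.mem_range.mp hj)
      rw [Polynomial.aeval_monomial, Algebra.smul_def, map_mul, map_mul, map_pow, map_pow,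
        ← IsScalarTower.algebraMap_apply, div_pow, mul_assoc]
      congr 1
      rw [div_mul_eq_mul_div, div_eq_iff (pow_ne_zero _ hyK), mul_assoc, ← pow_add,
        Nat.sub_add_cancel hjk]
    exact (mul_eq_zero.mp h2).resolve_right (pow_ne_zero _ hyK)
  have hint : IsIntegral ℂ w := isAlgebraic_iff_isIntegral.mp ⟨p, hp, hpw⟩
  obtain ⟨z, hz⟩ := minpoly.degree_eq_one_iff.mp
    (IsAlgClosed.degree_eq_one_of_irreducible ℂ (minpoly.irreducible hint))
  refine ⟨z, FaithfulSMul.algebraMap_injective A K ?_⟩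
  rw [Algebra.smul_def, map_mul, ← IsScalarTower.algebraMap_apply]
  have : algebraMap ℂ K z = algebraMap A K x / algebraMap A K y := hz
  rw [this, div_mul_cancel₀ _ hyK]

theorem map_iterate_mem {D : Derivation ℂ A A} {e : ℤ}
    (hhom : ∀ n : ℤ, ∀ a ∈ 𝒜 n, D a ∈ 𝒜 (n + e)) {i : ℤ} {a : A} (ha : a ∈ 𝒜 i) (n : ℕ) :
    (⇑D)^[n] a ∈ 𝒜 (i + n * e) := by
  induction n with
  | zero => simpa using ha
  | succ n ih =>
    rw [Function.iterate_succ_apply']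
    convert hhom _ _ ih using 2
    push_cast
    ring

variable [GradedAlgebra 𝒜]

theorem pow_mem_of_mem {i j : ℤ} {a : A} (ha : a ∈ 𝒜 i) (n : ℕ) (hj : n * i = j) :
    a ^ n ∈ 𝒜 j := by
  have h := SetLike.pow_mem_graded n ha
  rwa [nsmul_eq_mul, hj] at h

theorem mul_mem_of_mem {i j k : ℤ} {a b : A} (ha : a ∈ 𝒜 i) (hb : b ∈ 𝒜 j) (hk : i + j = k) :
    a * b ∈ 𝒜 k :=
  hk ▸ SetLike.mul_mem_graded ha hb

theorem exists_mem_map_ne_zero {D : Derivation ℂ A A} (hD : D ≠ 0) :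
    ∃ n : ℤ, ∃ v ∈ 𝒜 n, D v ≠ 0 := by
  by_contra! h
  refine hD (Derivation.ext fun x ↦ ?_)
  induction x using DirectSum.Decomposition.inductionOn 𝒜 with
  | zero => simp
  | homogeneous v => simpa using h _ v v.2
  | add x y hx hy => simp [hx, hy]

variable [IsDomain A] [Algebra.FiniteType ℂ A]

theorem exists_homogeneous_relation_of_ne_zero (hdim : ringKrullDim A ≤ (2 : ℕ)) {N : ℤ}
    (hN : N ≠ 0) {t x y : A} (ht : t ∈ 𝒜 0) (hx : x ∈ 𝒜 N) (hy : y ∈ 𝒜 N) :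
    ∃ (k L : ℕ) (c : ℕ → ℕ → ℂ), (∃ j < k + 1, ∃ l < L, c j l ≠ 0) ∧
      ∑ j ∈ Finset.range (k + 1), ∑ l ∈ Finset.range L, c j l • (t ^ l * (x ^ j * y ^ (k - j)))
        = 0 := by
  have hdep : ¬ AlgebraicIndependent ℂ ![t, x, y] := fun h ↦ by
    simpa using h.le_of_ringKrullDim_le hdim
  rw [algebraicIndependent_iff] at hdep
  push Not at hdep
  obtain ⟨P, hP, hP0⟩ := hdep
  obtain ⟨m₀, hm₀⟩ := MvPolynomial.support_nonempty.mpr hP0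
  set k := m₀ 1 + m₀ 2 with hk
  have hlt {m : Fin 3 →₀ ℕ} (hm : m ∈ P.support) : m 0 < P.degreeOf 0 + 1 :=
    Nat.lt_succ_iff.mpr (MvPolynomial.monomial_le_degreeOf 0 hm)
  let g (j l : ℕ) : Fin 3 →₀ ℕ := Finsupp.equivFunOnFinite.symm ![l, j, k - j]
  have hg {m : Fin 3 →₀ ℕ} (hm : m 1 + m 2 = k) : g (m 1) (m 0) = m := by
    ext i
    fin_cases i <;> simp [g, ← hm]
  refine ⟨k, P.degreeOf 0 + 1, fun j l ↦ P.coeff (g j l),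
    ⟨m₀ 1, by omega, m₀ 0, hlt hm₀, ?_⟩, ?_⟩
  · simpa [hg hk.symm] using hm₀
  have hterm (m : Fin 3 →₀ ℕ) : algebraMap ℂ A (P.coeff m) * ∏ i, ![t, x, y] i ^ m i ∈
      𝒜 (((m 1 + m 2 : ℕ) : ℤ) * N) := by
    rw [← Algebra.smul_def, Fin.prod_univ_three]
    refine Submodule.smul_mem _ _ ?_
    refine mul_mem_of_mem 𝒜 (mul_mem_of_mem 𝒜 (pow_mem_of_mem 𝒜 ht _ rfl)
      (pow_mem_of_mem 𝒜 hx _ rfl) rfl) (pow_mem_of_mem 𝒜 hy _ rfl) ?_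
    push_cast
    ring
  rw [MvPolynomial.aeval_def, MvPolynomial.eval₂_eq'] at hP
  have hproj := congrArg (GradedAlgebra.proj 𝒜 ((k : ℤ) * N)) hP
  rw [map_sum, map_zero] at hproj
  rw [← Finset.sum_product', ← hproj]
  symm
  rw [← Finset.sum_filter_of_ne (p := fun m : Fin 3 →₀ ℕ ↦ m 1 + m 2 = k)]
  · refine Finset.sum_of_injOn (fun m : Fin 3 →₀ ℕ ↦ (m 1, m 0)) ?_ ?_ ?_ ?_
    · intro m hm m' hm' h
      simp only [Finset.coe_filter, Set.mem_ofPred_eq, Prod.mk.injEq] at hm hm' h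
      rw [← hg hm.2, ← hg hm'.2, h.1, h.2]
    · intro m hm
      simp only [Finset.coe_filter, Set.mem_ofPred_eq] at hm
      have := hlt hm.1
      simp only [Finset.coe_product, Finset.coe_range, Set.mem_prod, Set.mem_Iio]
      omega
    · rintro ⟨j, l⟩ hjl hnot
      simp only [Finset.mem_product, Finset.mem_range] at hjl
      have : P.coeff (g j l) = 0 := by
        by_contra hne
        refine hnot ⟨g j l, ?_, by simp [g]⟩
        simp only [Finset.coe_filter, Set.mem_ofPred_eq, MvPolynomial.mem_support_iff]
        refine ⟨hne, ?_⟩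
        simp [g]
        omega
      simp [this]
    · intro m hm
      rw [Finset.mem_filter] at hm
      rw [GradedAlgebra.proj_apply, DirectSum.decompose_of_mem_same 𝒜 (hm.2 ▸ hterm m)]
      simp only [hg hm.2, Algebra.smul_def, Fin.prod_univ_three]
      have : k - m 1 = m 2 := by omega
      simp [this, mul_assoc]
  · intro m _ hne
    by_contra hmk
    apply hne
    rw [GradedAlgebra.proj_apply, DirectSum.decompose_of_mem_ne 𝒜 (hterm m)]
    intro h
    exact hmk (by exact_mod_cast mul_right_cancel₀ hN h)

theorem exists_homogeneous_relation (hdim : ringKrullDim A ≤ (2 : ℕ)) (hA1 : 𝒜 1 ≠ ⊥) {N : ℤ}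
    {t x y : A} (ht : t ∈ 𝒜 0) (hx : x ∈ 𝒜 N) (hy : y ∈ 𝒜 N) :
    ∃ (k L : ℕ) (c : ℕ → ℕ → ℂ), (∃ j < k + 1, ∃ l < L, c j l ≠ 0) ∧
      ∑ j ∈ Finset.range (k + 1), ∑ l ∈ Finset.range L, c j l • (t ^ l * (x ^ j * y ^ (k - j)))
        = 0 := by
  rcases ne_or_eq N 0 with hN | rfl
  · exact exists_homogeneous_relation_of_ne_zero 𝒜 hdim hN ht hx hy
  obtain ⟨u, hu, hu0⟩ := Submodule.exists_mem_ne_zero_of_ne_bot hA1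
  obtain ⟨k, L, c, hc, hsum⟩ := exists_homogeneous_relation_of_ne_zero 𝒜 hdim one_ne_zero ht
    (mul_mem_of_mem 𝒜 hx hu (zero_add 1)) (mul_mem_of_mem 𝒜 hy hu (zero_add 1))
  refine ⟨k, L, c, hc, mul_right_cancel₀ (pow_ne_zero k hu0) ?_⟩
  rw [zero_mul, ← hsum, Finset.sum_mul]
  refine Finset.sum_congr rfl fun j hj ↦ ?_
  rw [Finset.sum_mul]
  refine Finset.sum_congr rfl fun l _ ↦ ?_
  rw [smul_mul_assoc, mul_pow, mul_pow,
    show k = j + (k - j) by have := Finset.mem_range.mp hj; omega, pow_add]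
  simp only [Nat.add_sub_cancel_left]
  congr 1
  ring

theorem exists_eq_smul_of_map_eq_zero (hdim : ringKrullDim A ≤ (2 : ℕ)) (hA1 : 𝒜 1 ≠ ⊥)
    {D : Derivation ℂ A A} (hD : D.IsLocallyNilpotent) {a : A} (ha : a ∈ 𝒜 0) (hDa : D a ≠ 0)
    {N : ℤ} {x y : A} (hx : x ∈ 𝒜 N) (hy : y ∈ 𝒜 N) (hDx : D x = 0) (hDy : D y = 0)
    (hy0 : y ≠ 0) : ∃ c : ℂ, x = c • y := by
  obtain ⟨k, L, c, ⟨j₀, hj₀, l₀, hl₀, hc⟩, hsum⟩ :=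
    exists_homogeneous_relation 𝒜 hdim hA1 ha hx hy
  refine exists_eq_smul_of_sum_smul_pow_mul_pow_eq_zero hy0 (c := fun j ↦ c j l₀) ⟨j₀, hj₀, hc⟩
    (hD.coeff_eq_zero_of_sum_pow_mul_eq_zero hDa (s := Finset.range L)
      (b := fun l ↦ ∑ j ∈ Finset.range (k + 1), c j l • (x ^ j * y ^ (k - j))) ?_ ?_ l₀
      (Finset.mem_range.mpr hl₀))
  · intro l _
    rw [map_sum]
    refine Finset.sum_eq_zero fun j _ ↦ ?_
    simp [Derivation.leibniz_pow, hDx, hDy]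
  · rw [← hsum, Finset.sum_comm]
    refine Finset.sum_congr rfl fun l _ ↦ ?_
    rw [Finset.mul_sum]
    exact Finset.sum_congr rfl fun j _ ↦ mul_smul_comm _ _ _

omit [Algebra.FiniteType ℂ A] in
theorem exists_transcendental_mem_zero
    (hdim0 : ringKrullDim (SetLike.GradeZero.subalgebra 𝒜) = 1) :
    ∃ t ∈ 𝒜 0, Transcendental ℂ t := by
  by_contra! h
  have hint : Algebra.IsIntegral ℂ (SetLike.GradeZero.subalgebra 𝒜) := by
    refine ⟨fun x ↦ ?_⟩
    have hx : IsIntegral ℂ (x : A) :=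
      isAlgebraic_iff_isIntegral.mp (not_not.mp (h x x.2))
    exact (isIntegral_algHom_iff (SetLike.GradeZero.subalgebra 𝒜).val Subtype.val_injective).mp hx
  have hf : IsField (SetLike.GradeZero.subalgebra 𝒜) :=
    isField_of_isIntegral_of_isField' (Field.toIsField ℂ)
  rw [ringKrullDim_eq_zero_of_isField hf] at hdim0
  exact zero_ne_one hdim0

theorem exists_mem_zero_map_ne_zero_of_parabolic (hdim : ringKrullDim A ≤ (2 : ℕ))
    (hdim0 : ringKrullDim (SetLike.GradeZero.subalgebra 𝒜) = 1)
    (hneg : ∀ i : ℤ, i < 0 → 𝒜 i = ⊥) {e : ℤ} (he : 0 ≤ e) {D : Derivation ℂ A A}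
    (hD : D.IsLocallyNilpotent) (hD0 : D ≠ 0)
    (hhom : ∀ n : ℤ, ∀ a ∈ 𝒜 n, D a ∈ 𝒜 (n + e)) : ∃ a ∈ 𝒜 0, D a ≠ 0 := by
  by_contra! h
  obtain ⟨t, ht, htr⟩ := exists_transcendental_mem_zero 𝒜 hdim0
  obtain ⟨n, v, hv, hDv⟩ := exists_mem_map_ne_zero 𝒜 hD0
  have hv0 : v ≠ 0 := by rintro rfl; simp at hDv
  have hn : 0 < n := by
    rcases lt_trichotomy n 0 with hn | rfl | hn
    · rw [hneg n hn] at hv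
      exact absurd hv hv0
    · exact absurd (h v hv) hDv
    · exact hn
  lift n to ℕ using hn.le
  lift e to ℕ using he
  have hn' : n ≠ 0 := by omega
  obtain ⟨m, hm⟩ := hD.exists_hasOrder hv0
  obtain ⟨m, rfl⟩ := Nat.exists_eq_succ_of_ne_zero (hm.pos hDv).ne'
  have hx : D.HasOrder (D v ^ n) (n * m) := hm.map.pow n
  have hy : D.HasOrder (v ^ (n + e)) ((n + e) * (m + 1)) := hm.pow _
  have hlt : n * m < (n + e) * (m + 1) := by nlinarith [Nat.pos_of_ne_zero hn']
  obtain ⟨k, L, c, ⟨j₀, hj₀, l₀, hl₀, hc⟩, hsum⟩ :=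
    exists_homogeneous_relation_of_ne_zero 𝒜 hdim (N := n * (n + e)) (by positivity) ht
      (pow_mem_of_mem 𝒜 (hhom _ _ hv) n rfl)
      (pow_mem_of_mem 𝒜 hv (n + e) (by push_cast; ring))
  let b (j : ℕ) : A := ∑ l ∈ Finset.range L, c j l • t ^ l
  have hDb (j : ℕ) : D (b j) = 0 := by
    rw [map_sum]
    exact Finset.sum_eq_zero fun l _ ↦ by simp [Derivation.leibniz_pow, h t ht]
  have hsum' : ∑ j ∈ Finset.range (k + 1), b j * ((D v ^ n) ^ j * (v ^ (n + e)) ^ (k - j)) = 0 := by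
    rw [← hsum]
    refine Finset.sum_congr rfl fun j _ ↦ ?_
    rw [Finset.sum_mul]
    exact Finset.sum_congr rfl fun l _ ↦ by rw [smul_mul_assoc]
  have hinj : Set.InjOn (fun j ↦ j * (n * m) + (k - j) * ((n + e) * (m + 1)))
      (Finset.range (k + 1) : Finset ℕ) := by
    have hanti : ∀ i j : ℕ, i < j → j < k + 1 →
        j * (n * m) + (k - j) * ((n + e) * (m + 1)) <
          i * (n * m) + (k - i) * ((n + e) * (m + 1)) := by
      intro i j hij hj
      obtain ⟨r, rfl⟩ := Nat.exists_eq_add_of_lt hij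
      obtain ⟨q, rfl⟩ := Nat.exists_eq_add_of_le (Nat.lt_succ_iff.mp hj)
      rw [show i + r + 1 + q - (i + r + 1) = q by omega,
        show i + r + 1 + q - i = r + 1 + q by omega]
      nlinarith
    intro i hi j hj hij
    simp only [Finset.coe_range, Set.mem_Iio] at hi hj
    rcases lt_trichotomy i j with hlt | rfl | hlt
    · exact absurd hij (hanti i j hlt hj).ne'
    · rfl
    · exact absurd hij (hanti j i hlt hi).ne
  have hzero := Derivation.eq_zero_of_sum_eq_zero_of_hasOrder (D := D) (fun j _ hne ↦ by
    simpa using (Derivation.hasOrder_zero_iff.mpr ⟨left_ne_zero_of_mul hne, hDb j⟩).mul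
      ((hx.pow j).mul (hy.pow (k - j)))) hinj hsum' j₀ (Finset.mem_range.mpr hj₀)
  have hb : b j₀ = 0 := (mul_eq_zero.mp hzero).resolve_right
    (mul_ne_zero (pow_ne_zero _ hx.ne_zero) (pow_ne_zero _ hy.ne_zero))
  have hpoly := transcendental_iff.mp htr
    (∑ l ∈ Finset.range L, Polynomial.monomial l (c j₀ l)) (by
      rw [← hb, map_sum]
      exact Finset.sum_congr rfl fun l _ ↦ by
        rw [Polynomial.aeval_monomial, Algebra.smul_def])
  apply hc
  have := congrArg (Polynomial.coeff · l₀) hpoly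
  simpa [Polynomial.finsetSum_coeff, Polynomial.coeff_monomial, hl₀] using this

omit [Algebra.FiniteType ℂ A] in
theorem exists_mem_zero_map_ne_zero_of_hyperbolic (hA1 : 𝒜 1 ≠ ⊥) (hAneg1 : 𝒜 (-1) ≠ ⊥)
    {D : Derivation ℂ A A} (hD : D.IsLocallyNilpotent) (hD0 : D ≠ 0) : ∃ a ∈ 𝒜 0, D a ≠ 0 := by
  by_contra! h
  obtain ⟨u, hu, hu0⟩ := Submodule.exists_mem_ne_zero_of_ne_bot hA1
  obtain ⟨w, hw, hw0⟩ := Submodule.exists_mem_ne_zero_of_ne_bot hAneg1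
  obtain ⟨n, v, hv, hDv⟩ := exists_mem_map_ne_zero 𝒜 hD0
  have hv0 : v ≠ 0 := by rintro rfl; simp at hDv
  apply hDv
  rcases le_total 0 n with hn | hn
  · lift n to ℕ using hn
    exact hD.map_eq_zero_of_map_mul_eq_zero (mul_ne_zero hv0 (pow_ne_zero n hw0))
      (h _ (mul_mem_of_mem 𝒜 hv (pow_mem_of_mem 𝒜 hw n rfl) (by ring)))
  · obtain ⟨n, rfl⟩ := Int.exists_eq_neg_ofNat hn
    exact hD.map_eq_zero_of_map_mul_eq_zero (mul_ne_zero hv0 (pow_ne_zero n hu0))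
      (h _ (mul_mem_of_mem 𝒜 hv (pow_mem_of_mem 𝒜 hu n rfl) (by ring)))

theorem exists_iterate_sub_smul_eq_zero (hdim : ringKrullDim A ≤ (2 : ℕ)) (hA1 : 𝒜 1 ≠ ⊥)
    {e : ℤ} {D : Derivation ℂ A A} (hD : D.IsLocallyNilpotent)
    (hhom : ∀ n : ℤ, ∀ a ∈ 𝒜 n, D a ∈ 𝒜 (n + e)) {a : A} (ha : a ∈ 𝒜 0) (hDa : D a ≠ 0)
    {N : ℤ} {x y : A} (hx : x ∈ 𝒜 N) (hy : y ∈ 𝒜 N) {n : ℕ} (hxn : (⇑D)^[n + 1] x = 0)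
    (hyn : D.HasOrder y n) : ∃ c : ℂ, (⇑D)^[n] (x - c • y) = 0 := by
  obtain ⟨hyn0, hyn1⟩ := hyn
  rw [Function.iterate_succ_apply'] at hxn hyn1
  obtain ⟨c, hc⟩ := exists_eq_smul_of_map_eq_zero 𝒜 hdim hA1 hD ha hDa
    (map_iterate_mem 𝒜 hhom hx n) (map_iterate_mem 𝒜 hhom hy n) hxn hyn1 hyn0
  refine ⟨c, ?_⟩
  have h := map_sub ((D : A →ₗ[ℂ] A) ^ n) x (c • y)
  rw [map_smul] at h
  simp only [Module.End.pow_apply] at h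
  exact h.trans (sub_eq_zero.mpr hc)

theorem exists_fg_submodule_forall_div_pow_mem (hdim : ringKrullDim A ≤ (2 : ℕ))
    (hA1 : 𝒜 1 ≠ ⊥) {e : ℤ} {D : Derivation ℂ A A} (hD : D.IsLocallyNilpotent)
    (hhom : ∀ n : ℤ, ∀ a ∈ 𝒜 n, D a ∈ 𝒜 (n + e)) {a : A} (ha : a ∈ 𝒜 0) (hDa : D a ≠ 0)
    {d : ℤ} {p : A} (hp : p ∈ 𝒜 d) (hDp : D p = 0) (hp0 : p ≠ 0) (K : Type*) [Field K]
    [Algebra A K] [IsFractionRing A K] :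
    ∃ M : Submodule A K, M.FG ∧
      ∀ k : ℕ, ∀ y ∈ 𝒜 (k * d), algebraMap A K y / algebraMap A K p ^ k ∈ M := by
  have hpK : algebraMap A K p ≠ 0 := by simpa using hp0
  obtain ⟨m, hm⟩ := hD.exists_hasOrder (x := a) (by rintro rfl; simp at hDa)
  have hm0 := hm.pos hDa
  have hmin (r : Fin m) : ∃ (k : ℕ) (y : A), y ∈ 𝒜 (k * d) ∧ ∀ (n k' : ℕ), ∀ y' ∈ 𝒜 (k' * d),
      D.HasOrder y' n → n % m = r → ∃ j n₀, n = j * m + n₀ ∧ D.HasOrder y n₀ := by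
    classical
    by_cases hex : ∃ n : ℕ, n % m = r ∧ ∃ k : ℕ, ∃ y ∈ 𝒜 (k * d), D.HasOrder y n
    · obtain ⟨hr, k, y, hy, hyn⟩ := Nat.find_spec hex
      refine ⟨k, y, hy, fun n k' y' hy' hn hnr ↦ ?_⟩
      have hle : Nat.find hex ≤ n := Nat.find_min' hex ⟨hnr, k', y', hy', hn⟩
      have hdvd : m ∣ n - Nat.find hex := (Nat.modEq_iff_dvd' hle).mp (hr.trans hnr.symm)
      refine ⟨(n - Nat.find hex) / m, _, ?_, hyn⟩
      rw [Nat.div_mul_cancel hdvd, Nat.sub_add_cancel hle]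
    · exact ⟨0, 0, zero_mem _, fun n k' y' hy' hn hnr ↦ absurd ⟨n, hnr, k', y', hy', hn⟩ hex⟩
  choose k₀ y₀ hy₀ hmin using hmin
  let g (r : Fin m) : K := algebraMap A K (y₀ r) / algebraMap A K p ^ k₀ r
  refine ⟨Submodule.span A (Set.range g), Submodule.fg_span (Set.finite_range g), ?_⟩
  suffices h : ∀ n k : ℕ, ∀ y ∈ 𝒜 (k * d), (⇑D)^[n] y = 0 →
      algebraMap A K y / algebraMap A K p ^ k ∈ Submodule.span A (Set.range g) by
    intro k y hy
    obtain ⟨n, hn⟩ := hD y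
    exact h n k y hy hn
  intro n
  induction n with
  | zero =>
    rintro k y - hy
    simp [show y = 0 from hy]
  | succ n ih =>
    intro k y hy hyn1
    by_cases hyn : (⇑D)^[n] y = 0
    · exact ih k y hy hyn
    let r : Fin m := ⟨n % m, Nat.mod_lt n hm0⟩
    obtain ⟨j, n₀, hj, hn₀⟩ := hmin r n k y hy ⟨hyn, hyn1⟩ rfl
    have hpow (i : ℕ) : D.HasOrder (p ^ i) 0 := by
      simpa using (Derivation.hasOrder_zero_iff.mpr ⟨hp0, hDp⟩).pow i
    have hx : D.HasOrder (y * p ^ k₀ r) n := by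
      simpa using Derivation.HasOrder.mul ⟨hyn, hyn1⟩ (hpow (k₀ r))
    have hz : D.HasOrder (a ^ j * y₀ r * p ^ k) n := by
      rw [hj]
      simpa using ((hm.pow j).mul hn₀).mul (hpow k)
    have hxmem : y * p ^ k₀ r ∈ 𝒜 ((k + k₀ r : ℕ) * d) :=
      mul_mem_of_mem 𝒜 hy (pow_mem_of_mem 𝒜 hp _ rfl) (by push_cast; ring)
    have hzmem : a ^ j * y₀ r * p ^ k ∈ 𝒜 ((k + k₀ r : ℕ) * d) :=
      mul_mem_of_mem 𝒜 (mul_mem_of_mem 𝒜 (pow_mem_of_mem 𝒜 ha j (mul_zero _)) (hy₀ r) rfl)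
        (pow_mem_of_mem 𝒜 hp _ rfl) (by push_cast; ring)
    obtain ⟨c, hc⟩ := exists_iterate_sub_smul_eq_zero 𝒜 hdim hA1 hD hhom ha hDa hxmem hzmem
      hx.2 hz
    have hmem := ih _ _ (sub_mem hxmem (Submodule.smul_mem _ c hzmem)) hc
    have hg : (algebraMap ℂ A c * a ^ j) • g r ∈ Submodule.span A (Set.range g) :=
      Submodule.smul_mem _ _ (Submodule.subset_span ⟨r, rfl⟩)
    convert add_mem hmem hg using 1
    simp only [g, Algebra.smul_def, map_sub, map_mul, map_pow, pow_add]
    field_simp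
    ring

theorem exists_eq_mul_of_map_eq_zero [IsIntegrallyClosed A] (hdim : ringKrullDim A ≤ (2 : ℕ))
    (hA1 : 𝒜 1 ≠ ⊥) {e : ℤ} {D : Derivation ℂ A A} (hD : D.IsLocallyNilpotent)
    (hhom : ∀ n : ℤ, ∀ a ∈ 𝒜 n, D a ∈ 𝒜 (n + e)) {a : A} (ha : a ∈ 𝒜 0) (hDa : D a ≠ 0)
    {d : ℤ} {p q : A} (hp : p ∈ 𝒜 d) (hDp : D p = 0) (hp0 : p ≠ 0) (hq : q ∈ 𝒜 d) :
    ∃ b, q = b * p := by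
  let K := FractionRing A
  have hpK : algebraMap A K p ≠ 0 := by simpa using hp0
  obtain ⟨M, hM, hmem⟩ := exists_fg_submodule_forall_div_pow_mem 𝒜 hdim hA1 hD hhom ha hDa hp hDp
    hp0 K
  have : IsNoetherianRing A := Algebra.FiniteType.isNoetherianRing ℂ A
  let z : K := algebraMap A K q / algebraMap A K p
  have hle : Subalgebra.toSubmodule (Algebra.adjoin A {z}) ≤ M := by
    rw [Algebra.adjoin_eq_span, Submodule.span_le]
    intro w hw
    obtain ⟨k, rfl⟩ := Submonoid.mem_closure_singleton.mp hw
    have := hmem k _ (pow_mem_of_mem 𝒜 hq k rfl)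
    rwa [map_pow, ← div_pow] at this
  have hint : IsIntegral A z := IsIntegral.of_mem_of_fg (Algebra.adjoin A {z})
    (Submodule.FG.of_le hM hle) z (Algebra.self_mem_adjoin_singleton A z)
  obtain ⟨b, hb⟩ := IsIntegrallyClosed.isIntegral_iff.mp hint
  refine ⟨b, FaithfulSMul.algebraMap_injective A K ?_⟩
  rw [map_mul, hb, div_mul_cancel₀ _ hpK]

theorem map_eq_zero_of_mem_of_map_eq_zero [IsIntegrallyClosed A] (hdim : ringKrullDim A ≤ (2 : ℕ))
    (hA1 : 𝒜 1 ≠ ⊥) {e : ℤ} {D D' : Derivation ℂ A A} (hD : D.IsLocallyNilpotent)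
    (hD' : D'.IsLocallyNilpotent) (hhom : ∀ n : ℤ, ∀ a ∈ 𝒜 n, D a ∈ 𝒜 (n + e))
    (hhom' : ∀ n : ℤ, ∀ a ∈ 𝒜 n, D' a ∈ 𝒜 (n + e)) {a a' : A} (ha : a ∈ 𝒜 0) (hDa : D a ≠ 0)
    (ha' : a' ∈ 𝒜 0) (hDa' : D' a' ≠ 0) {d : ℤ} {p q : A} (hp : p ∈ 𝒜 d) (hDp : D p = 0)
    (hp0 : p ≠ 0) (hq : q ∈ 𝒜 d) (hDq : D' q = 0) (hq0 : q ≠ 0) : D q = 0 := by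
  obtain ⟨b, hb⟩ := exists_eq_mul_of_map_eq_zero 𝒜 hdim hA1 hD hhom ha hDa hp hDp hp0 hq
  obtain ⟨b', hb'⟩ := exists_eq_mul_of_map_eq_zero 𝒜 hdim hA1 hD' hhom' ha' hDa' hq hDq hq0 hp
  have h1 : b * b' = 1 := by
    refine mul_right_cancel₀ hq0 ?_
    rw [mul_assoc, ← hb', ← hb, one_mul]
  have hDb : D b = 0 := hD.map_eq_zero_of_map_mul_eq_zero (y := b') (by simp [h1]) (by simp [h1])
  rw [hb, Derivation.leibniz, hDb, hDp, smul_zero, smul_zero, add_zero]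

omit [GradedAlgebra 𝒜] [IsDomain A] [Algebra.FiniteType ℂ A] in
theorem exists_mem_ne_zero_map_eq_zero {e : ℤ} {D : Derivation ℂ A A}
    (hD : D.IsLocallyNilpotent) (hhom : ∀ n : ℤ, ∀ a ∈ 𝒜 n, D a ∈ 𝒜 (n + e)) {i : ℤ}
    (hi : 𝒜 i ≠ ⊥) : ∃ k : ℕ, ∃ p ∈ 𝒜 (i + k * e), p ≠ 0 ∧ D p = 0 := by
  obtain ⟨u, hu, hu0⟩ := Submodule.exists_mem_ne_zero_of_ne_bot hi
  obtain ⟨k, hk0, hk1⟩ := hD.exists_hasOrder hu0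
  rw [Function.iterate_succ_apply'] at hk1
  exact ⟨k, _, map_iterate_mem 𝒜 hhom hu k, hk0, hk1⟩

theorem natAbs_mul_comm_of_nonneg_mul {m n : ℤ} (h : 0 ≤ m * n) :
    (m.natAbs : ℤ) * n = n.natAbs * m := by
  rw [Int.natCast_natAbs, Int.natCast_natAbs]
  rcases mul_nonneg_iff.mp h with ⟨hm, hn⟩ | ⟨hm, hn⟩
  · rw [abs_of_nonneg hm, abs_of_nonneg hn, mul_comm]
  · rw [abs_of_nonpos hm, abs_of_nonpos hn]
    ring

theorem exists_common_mem_map_eq_zero [IsIntegrallyClosed A] (hdim : ringKrullDim A ≤ (2 : ℕ))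
    (hA1 : 𝒜 1 ≠ ⊥) {e : ℤ} {D D' : Derivation ℂ A A} (hD : D.IsLocallyNilpotent)
    (hD' : D'.IsLocallyNilpotent) (hhom : ∀ n : ℤ, ∀ a ∈ 𝒜 n, D a ∈ 𝒜 (n + e))
    (hhom' : ∀ n : ℤ, ∀ a ∈ 𝒜 n, D' a ∈ 𝒜 (n + e)) {a a' : A} (ha : a ∈ 𝒜 0) (hDa : D a ≠ 0)
    (ha' : a' ∈ 𝒜 0) (hDa' : D' a' ≠ 0) {i : ℤ} (hi : 𝒜 i ≠ ⊥) (hi0 : i ≠ 0)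
    (hie : 0 ≤ i * e) : ∃ d : ℤ, d ≠ 0 ∧ ∃ p ∈ 𝒜 d, p ≠ 0 ∧ D p = 0 ∧ D' p = 0 := by
  obtain ⟨k, p, hp, hp0, hDp⟩ := exists_mem_ne_zero_map_eq_zero 𝒜 hD hhom hi
  obtain ⟨l, q, hq, hq0, hDq⟩ := exists_mem_ne_zero_map_eq_zero 𝒜 hD' hhom' hi
  have hpos : 0 < (i + k * e) * (i + l * e) := by
    have h : (i + k * e) * (i + l * e) = i ^ 2 + (k + l) * (i * e) + k * l * e ^ 2 := by ring
    rw [h]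
    positivity
  have hqpow : D' (q ^ (i + k * e).natAbs) = 0 := by simp [Derivation.leibniz_pow, hDq]
  refine ⟨_, ?_, _, pow_mem_of_mem 𝒜 hq (i + k * e).natAbs rfl, pow_ne_zero _ hq0, ?_, hqpow⟩
  · exact mul_ne_zero (by simpa using left_ne_zero_of_mul hpos.ne')
      (right_ne_zero_of_mul hpos.ne')
  · exact map_eq_zero_of_mem_of_map_eq_zero 𝒜 hdim hA1 hD hD' hhom hhom' ha hDa ha' hDa'
      (pow_mem_of_mem 𝒜 hp (i + l * e).natAbs (natAbs_mul_comm_of_nonneg_mul hpos.le).symm)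
      (by simp [Derivation.leibniz_pow, hDp]) (pow_ne_zero _ hp0)
      (pow_mem_of_mem 𝒜 hq _ rfl) hqpow (pow_ne_zero _ hq0)

theorem map_eq_zero_of_mem_of_common (hdim : ringKrullDim A ≤ (2 : ℕ)) (hA1 : 𝒜 1 ≠ ⊥)
    {D D' : Derivation ℂ A A} (hD : D.IsLocallyNilpotent) (hD' : D'.IsLocallyNilpotent)
    {a : A} (ha : a ∈ 𝒜 0) (hDa : D a ≠ 0) {d : ℤ} (hd : d ≠ 0) {p : A} (hp : p ∈ 𝒜 d)
    (hp0 : p ≠ 0) (hDp : D p = 0) (hDp' : D' p = 0) {N : ℤ} {x : A} (hx : x ∈ 𝒜 N)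
    (hDx : D x = 0) : D' x = 0 := by
  have hd' : d.natAbs ≠ 0 := by simpa using hd
  rcases le_or_gt 0 (N * d) with h | h
  · obtain ⟨c, hc⟩ := exists_eq_smul_of_map_eq_zero 𝒜 hdim hA1 hD ha hDa
      (pow_mem_of_mem 𝒜 hx d.natAbs rfl)
      (pow_mem_of_mem 𝒜 hp N.natAbs (natAbs_mul_comm_of_nonneg_mul h))
      (by simp [Derivation.leibniz_pow, hDx]) (by simp [Derivation.leibniz_pow, hDp])
      (pow_ne_zero _ hp0)
    exact hD'.map_eq_zero_of_map_pow_eq_zero hd' (by simp [hc, Derivation.leibniz_pow, hDp'])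
  · by_cases hx0 : x = 0
    · simp [hx0]
    have hdeg : (d.natAbs : ℤ) * N + N.natAbs * d = 0 := by
      have := natAbs_mul_comm_of_nonneg_mul (m := N) (n := -d) (by linarith)
      rw [Int.natAbs_neg] at this
      linarith
    obtain ⟨c, hc⟩ := exists_eq_smul_of_map_eq_zero 𝒜 hdim hA1 hD ha hDa
      (mul_mem_of_mem 𝒜 (pow_mem_of_mem 𝒜 hx d.natAbs rfl) (pow_mem_of_mem 𝒜 hp N.natAbs rfl) hdeg)
      SetLike.GradedOne.one_mem (by simp [Derivation.leibniz_pow, hDx, hDp]) (by simp) one_ne_zero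
    refine hD'.map_eq_zero_of_map_pow_eq_zero hd' (hD'.map_eq_zero_of_map_mul_eq_zero
      (mul_ne_zero (pow_ne_zero d.natAbs hx0) (pow_ne_zero N.natAbs hp0)) ?_)
    simp [hc]

omit [IsDomain A] [Algebra.FiniteType ℂ A] in
theorem decompose_map {e : ℤ} {D : Derivation ℂ A A}
    (hhom : ∀ n : ℤ, ∀ a ∈ 𝒜 n, D a ∈ 𝒜 (n + e)) (x : A) (n : ℤ) :
    (DirectSum.decompose 𝒜 (D x) (n + e) : A) = D (DirectSum.decompose 𝒜 x n) := by
  induction x using DirectSum.Decomposition.inductionOn 𝒜 with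
  | zero => simp
  | @homogeneous i v =>
    have hv := hhom _ _ v.2
    by_cases h : i = n
    · subst h
      rw [DirectSum.decompose_of_mem_same 𝒜 hv, DirectSum.decompose_of_mem_same 𝒜 v.2]
    · rw [DirectSum.decompose_of_mem_ne 𝒜 hv (by simpa using h),
        DirectSum.decompose_of_mem_ne 𝒜 v.2 h, map_zero]
  | add x y hx hy => simp [DirectSum.decompose_add, hx, hy]

omit [IsDomain A] [Algebra.FiniteType ℂ A] in
theorem map_eq_zero_of_forall_mem {e : ℤ} {D D' : Derivation ℂ A A}
    (hhom : ∀ n : ℤ, ∀ a ∈ 𝒜 n, D a ∈ 𝒜 (n + e))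
    (h : ∀ n : ℤ, ∀ x ∈ 𝒜 n, D x = 0 → D' x = 0) {x : A} (hx : D x = 0) : D' x = 0 := by
  classical
  rw [← DirectSum.sum_support_decompose 𝒜 x, map_sum]
  refine Finset.sum_eq_zero fun n _ ↦ h n _ (SetLike.coe_mem _) ?_
  rw [← decompose_map 𝒜 hhom, hx]
  simp

end Graded

namespace Derivation

variable {A : Type*} [CommRing A] [Algebra ℂ A] [IsDomain A] {D D' : Derivation ℂ A A} {s : A}

theorem map_mul_map_eq_of_map_map_eq_zero (hD : D.IsLocallyNilpotent)
    (h : ∀ x, D x = 0 → D' x = 0) (hs : D s ≠ 0) (hs2 : D (D s) = 0) (x : A) :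
    D s * D' x = D' s * D x := by
  have hs1 : D.HasOrder s 1 := ⟨hs, hs2⟩
  suffices H : ∀ n : ℕ, ∀ x, (⇑D)^[n] x = 0 → D s * D' x = D' s * D x by
    obtain ⟨n, hn⟩ := hD x
    exact H n x hn
  intro n
  induction n with
  | zero =>
    intro x hx
    simp [show x = 0 from hx]
  | succ n ih =>
    intro x hx
    set w := (⇑D)^[n] (s ^ n) with hw
    set v := (⇑D)^[n] x with hv
    obtain ⟨hw0, hDw⟩ : D.HasOrder (s ^ n) n := by simpa using hs1.pow n
    rw [Function.iterate_succ_apply'] at hDw hx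
    rw [← hw] at hw0 hDw
    rw [← hv] at hx
    have hk (c y : A) (hc : D c = 0) (m : ℕ) : (⇑D)^[m] (c * y) = c * (⇑D)^[m] y := by
      induction m with
      | zero => rfl
      | succ m hm => simp [Function.iterate_succ_apply', hm, hc]
    have hlow := ih (w * x - v * s ^ n) (by
      rw [iterate_map_sub, hk w x hDw, hk v _ hx, ← hw, ← hv]
      ring)
    simp only [map_sub, leibniz, leibniz_pow, smul_eq_mul, nsmul_eq_mul, hDw, hx, h _ hDw,
      h _ hx] at hlow
    refine mul_left_cancel₀ hw0 ?_
    linear_combination hlow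

theorem map_map_eq_zero_of_map_mul_map_eq (hD' : D'.IsLocallyNilpotent)
    (h : ∀ x, D' x = 0 → D x = 0) (hr : D' (D s) = 0) (hs : D s ≠ 0)
    (heq : ∀ x, D s * D' x = D' s * D x) : D (D' s) = 0 := by
  by_contra hy
  have hy' : D' (D' s) ≠ 0 := fun h0 ↦ hy (h _ h0)
  obtain ⟨n, hn⟩ := hD'.exists_hasOrder (x := D' s) (by intro h0; simp [h0] at hy)
  obtain ⟨k, rfl⟩ := Nat.exists_eq_succ_of_ne_zero (hn.pos hy').ne'
  obtain ⟨j, hj⟩ := hD'.exists_hasOrder hy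
  have h1 : D'.HasOrder (D s * D' (D' s)) (0 + k) :=
    (hasOrder_zero_iff.mpr ⟨hs, hr⟩).mul hn.map
  rw [heq] at h1
  have := h1.unique (hn.mul hj)
  omega

end Derivation

theorem exists_eq_smul_of_homogeneous {A : Type*} [CommRing A] [IsDomain A] [Algebra ℂ A]
    [Algebra.FiniteType ℂ A] (𝒜 : ℤ → Submodule ℂ A) [GradedAlgebra 𝒜]
    (hdim : ringKrullDim A ≤ (2 : ℕ)) (hA1 : 𝒜 1 ≠ ⊥) {e : ℤ} {D D' : Derivation ℂ A A}
    (hD : D.IsLocallyNilpotent) (hD' : D'.IsLocallyNilpotent)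
    (hhom : ∀ n : ℤ, ∀ a ∈ 𝒜 n, D a ∈ 𝒜 (n + e)) (hhom' : ∀ n : ℤ, ∀ a ∈ 𝒜 n, D' a ∈ 𝒜 (n + e))
    {a : A} (ha : a ∈ 𝒜 0) (hDa : D a ≠ 0) (hker : ∀ x, D x = 0 ↔ D' x = 0) :
    ∃ c : ℂ, D' = c • D := by
  obtain ⟨m, hm⟩ := hD.exists_hasOrder (x := a) (by rintro rfl; simp at hDa)
  obtain ⟨m, rfl⟩ := Nat.exists_eq_succ_of_ne_zero (hm.pos hDa).ne'
  obtain ⟨hs, hs2⟩ := hm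
  set s := (⇑D)^[m] a
  rw [Function.iterate_succ_apply'] at hs
  rw [Function.iterate_succ_apply', Function.iterate_succ_apply'] at hs2
  have hsmem := map_iterate_mem 𝒜 hhom ha m
  have heq := Derivation.map_mul_map_eq_of_map_map_eq_zero hD (fun x ↦ (hker x).mp) hs hs2
  obtain ⟨c, hc⟩ := exists_eq_smul_of_map_eq_zero 𝒜 hdim hA1 hD ha hDa (hhom' _ _ hsmem)
    (hhom _ _ hsmem) (Derivation.map_map_eq_zero_of_map_mul_map_eq hD' (fun x ↦ (hker x).mpr)
      ((hker _).mp hs2) hs heq) hs2 hs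
  refine ⟨c, Derivation.ext fun x ↦ mul_left_cancel₀ hs ?_⟩
  rw [heq x, hc]
  simp

/-- Let `A = ⊕_{i ∈ ℤ} A_i` be a `ℤ`-graded finitely generated normal domain
over `ℂ` of Krull dimension `2` with `A_0` of Krull dimension `1` and `A_1 ≠ 0`, which is
parabolic (`A_i = 0` for `i < 0`) or hyperbolic (`A_{-1} ≠ 0`).  Let `D`, `D'` be nonzero
locally nilpotent `ℂ`-derivations of `A`, both homogeneous of the same degree `e`; in the
parabolic case assume `e ≥ 0`.  Then `D' = c • D` for some nonzero constant `c ∈ ℂ`. -/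
theorem homogeneous_lnd_unique_up_to_constant
    {A : Type*} [CommRing A] [IsDomain A] [Algebra ℂ A] [Algebra.FiniteType ℂ A]
    [IsIntegrallyClosed A]
    (𝒜 : ℤ → Submodule ℂ A) [GradedAlgebra 𝒜]
    (hdim : ringKrullDim A = 2)
    (hdim0 : ringKrullDim (SetLike.GradeZero.subalgebra 𝒜) = 1)
    (hA1 : 𝒜 1 ≠ ⊥)
    (e : ℤ)
    (hcase : ((∀ i : ℤ, i < 0 → 𝒜 i = ⊥) ∧ 0 ≤ e) ∨ 𝒜 (-1) ≠ ⊥)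
    (D D' : Derivation ℂ A A)
    (hD : D.IsLocallyNilpotent) (hD' : D'.IsLocallyNilpotent)
    (hDne : D ≠ 0) (hD'ne : D' ≠ 0)
    (hhom : ∀ (n : ℤ), ∀ a ∈ 𝒜 n, D a ∈ 𝒜 (n + e))
    (hhom' : ∀ (n : ℤ), ∀ a ∈ 𝒜 n, D' a ∈ 𝒜 (n + e)) :
    ∃ c : ℂ, c ≠ 0 ∧ D' = c • D := by
  have hdim' : ringKrullDim A ≤ (2 : ℕ) := hdim.le
  have hzero (E : Derivation ℂ A A) (hE : E.IsLocallyNilpotent) (hE0 : E ≠ 0)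
      (hhomE : ∀ n : ℤ, ∀ a ∈ 𝒜 n, E a ∈ 𝒜 (n + e)) : ∃ a ∈ 𝒜 0, E a ≠ 0 := by
    rcases hcase with ⟨hneg, he⟩ | hneg1
    · exact exists_mem_zero_map_ne_zero_of_parabolic 𝒜 hdim' hdim0 hneg he hE hE0 hhomE
    · exact exists_mem_zero_map_ne_zero_of_hyperbolic 𝒜 hA1 hneg1 hE hE0
  obtain ⟨a, ha, hDa⟩ := hzero D hD hDne hhom
  obtain ⟨a', ha', hDa'⟩ := hzero D' hD' hD'ne hhom'
  obtain ⟨i, hi, hi0, hie⟩ : ∃ i : ℤ, 𝒜 i ≠ ⊥ ∧ i ≠ 0 ∧ 0 ≤ i * e := by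
    rcases le_or_gt 0 e with he | he
    · exact ⟨1, hA1, one_ne_zero, by simpa using he⟩
    · exact ⟨-1, hcase.resolve_left fun h ↦ he.not_ge h.2, by simp, by linarith⟩
  obtain ⟨d, hd, p, hp, hp0, hDp, hDp'⟩ := exists_common_mem_map_eq_zero 𝒜 hdim' hA1 hD hD' hhom
    hhom' ha hDa ha' hDa' hi hi0 hie
  obtain ⟨c, hc⟩ := exists_eq_smul_of_homogeneous 𝒜 hdim' hA1 hD hD' hhom hhom' ha hDa fun x ↦
    ⟨map_eq_zero_of_forall_mem 𝒜 hhom fun n y hy ↦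
      map_eq_zero_of_mem_of_common 𝒜 hdim' hA1 hD hD' ha hDa hd hp hp0 hDp hDp' hy,
    map_eq_zero_of_forall_mem 𝒜 hhom' fun n y hy ↦
      map_eq_zero_of_mem_of_common 𝒜 hdim' hA1 hD' hD ha' hDa' hd hp hp0 hDp' hDp hy⟩
  refine ⟨c, ?_, hc⟩
  rintro rfl
  exact hD'ne (by simpa using hc)
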